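/- Let X be a complex Banach space and S a closed, densely defined operator in X such that the imaginary axis iℝ is contained in the resolvent set ρ(S), such that ‖(S − iη)^{-1}‖ → 0 as |η| → ∞ (η real), and such that the principal value integral (1/(πi)) ∫_{iℝ} (S − z)^{-1} dz (principal value at infinity) exists in the strong operator topology. Then there exist complementary bounded projections Q_+ and Q_− in X (Q_+ + Q_− = I) such that Q_± dom(S) ⊂ dom(S) and S Q_± x = Q_± S x for all x ∈ dom(S), such that the spectra of the restrictions satisfy σ(S|_{Q_± X}) = σ(S) ∩ ℂ_±, where ℂ_± := {z ∈ ℂ : ± Re z > 0}, and such that (1/(πi)) ∫_{iℝ} (S − z)^{-1} dz x = Q_+ x − Q_− x for all x ∈ X. -/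

import Mathlib

noncomputable section

open Complex Filter Topology MeasureTheory

namespace Paper

variable {X : Type*} [NormedAddCommGroup X] [NormedSpace ℂ X]

/-- `R` is a (two-sided) bounded resolvent of the unbounded operator `T` at the point `z`. -/
def IsResolventAt (T : X →ₗ.[ℂ] X) (z : ℂ) (R : X →L[ℂ] X) : Prop :=
  (∀ u : T.domain, R (T u - z • (u : X)) = u) ∧
  (∀ y : X, ∃ hy : R y ∈ T.domain, T ⟨R y, hy⟩ - z • R y = y)

/-- The resolvent set of an unbounded operator. -/
def resolventSet (T : X →ₗ.[ℂ] X) : Set ℂ := {z | ∃ R, IsResolventAt T z R}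

/-- The spectrum of an unbounded operator. -/
def spec (T : X →ₗ.[ℂ] X) : Set ℂ := (resolventSet T)ᶜ

open Classical in
/-- The resolvent operator of `T` at `z` (junk value `0` if `z` is not in the resolvent set). -/
def res (T : X →ₗ.[ℂ] X) (z : ℂ) : X →L[ℂ] X :=
  if h : z ∈ resolventSet T then Classical.choose h else 0

open Classical in
/-- Application of an unbounded operator, with junk value `0` outside of the domain. -/
def pApply (T : X →ₗ.[ℂ] X) (u : X) : X :=
  if h : u ∈ T.domain then T ⟨u, h⟩ else 0

/-- `R` is a bounded resolvent at `z` of the part of `T` in the range of the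
(not necessarily orthogonal) projection `Q`. -/
def IsPartResolventAt (T : X →ₗ.[ℂ] X) (Q : X →L[ℂ] X) (z : ℂ) (R : X →L[ℂ] X) : Prop :=
  (∀ y, R (Q y) = R y) ∧ (∀ y, Q (R y) = R y) ∧
  (∀ y, ∃ hy : R y ∈ T.domain, T ⟨R y, hy⟩ - z • R y = Q y) ∧
  (∀ u : T.domain, Q (u : X) = (u : X) → R (T u - z • (u : X)) = (u : X))

/-- The spectrum of the part `T|_{ran Q}` of `T` in the range of the projection `Q`. -/
def partSpec (T : X →ₗ.[ℂ] X) (Q : X →L[ℂ] X) : Set ℂ :=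
  {z | ¬∃ R, IsPartResolventAt T Q z R}

/-- `T` is decomposed according to `X = Q₊X ∔ Q₋X`: the `Q₊, Q₋` are complementary (bounded)
projections whose ranges are invariant under `T`. -/
def DecomposedBy (T : X →ₗ.[ℂ] X) (Qp Qm : X →L[ℂ] X) : Prop :=
  Qp + Qm = 1 ∧ IsIdempotentElem Qp ∧ IsIdempotentElem Qm ∧
  (∀ u : T.domain, ∃ hp : Qp (u : X) ∈ T.domain, T ⟨Qp (u : X), hp⟩ = Qp (T u)) ∧
  (∀ u : T.domain, ∃ hm : Qm (u : X) ∈ T.domain, T ⟨Qm (u : X), hm⟩ = Qm (T u))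

/-- `D` is a core for the closed operator `T`: the closure of the restriction of `T` to `D`
is again `T`. -/
def IsCore (T : X →ₗ.[ℂ] X) (D : Submodule ℂ X) : Prop :=
  D ≤ T.domain ∧ (T.domRestrict D).closure = T

/-- The operator `W⁻¹ T W` (with `W' = W⁻¹`). -/
def conjPMap (W W' : X →L[ℂ] X) (T : X →ₗ.[ℂ] X) : X →ₗ.[ℂ] X where
  domain := T.domain.comap (W : X →ₗ[ℂ] X)
  toFun := (W' : X →ₗ[ℂ] X) ∘ₗ (T.toFun ∘ₗ ((W : X →ₗ[ℂ] X).restrict fun _ hx => hx))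

/-- The linear span of the graph of `f` restricted to `D`; if `f` is linear on `D` this is
the graph of the corresponding operator with domain `D`. -/
def graphSpan (D : Submodule ℂ X) (f : X → X) : Submodule ℂ (X × X) :=
  Submodule.span ℂ {p : X × X | p.1 ∈ D ∧ p.2 = f p.1}

/-- The unbounded operator with domain `D` acting as `f` (obtained from the span of the
graph of `f|_D`). -/
def pmapOf (D : Submodule ℂ X) (f : X → X) : X →ₗ.[ℂ] X := (graphSpan D f).toLinearPMap

theorem I_mul_ofReal_sub_ne_zero {z : ℂ} (hz : z.re ≠ 0) (η : ℝ) : I * (η : ℂ) - z ≠ 0 := by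
  intro h
  have := congrArg Complex.re h
  simp at this
  exact hz this

theorem norm_inv_I_mul_ofReal_sub_sq (z : ℂ) (η : ℝ) :
    ‖(I * (η : ℂ) - z)⁻¹‖ ^ 2 = (z.re ^ 2 + (η - z.im) ^ 2)⁻¹ := by
  rw [norm_inv, inv_pow, ← Complex.normSq_eq_norm_sq, Complex.normSq_apply]
  congr 1
  simp
  ring

theorem norm_inv_I_mul_ofReal_sub_le {z : ℂ} (hz : z.re ≠ 0) (η : ℝ) :
    ‖(I * (η : ℂ) - z)⁻¹‖ ≤ |z.re|⁻¹ := by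
  rw [norm_inv]
  have h := Complex.abs_re_le_norm (I * (η : ℂ) - z)
  gcongr
  simpa using h

theorem integrable_inv_sq_add_sq {d : ℝ} (hd : d ≠ 0) :
    Integrable (fun η : ℝ => (d ^ 2 + η ^ 2)⁻¹) := by
  have h := (integrable_inv_one_add_sq.comp_div hd).const_mul (d ^ 2)⁻¹
  refine h.congr (ae_of_all _ fun η => ?_)
  have : 1 + (η / d) ^ 2 ≠ 0 := by positivity
  have : d ^ 2 + η ^ 2 ≠ 0 := by positivity
  simp only
  rw [← mul_inv]
  congr 1
  field_simp

theorem integrable_norm_inv_sq {z : ℂ} (hz : z.re ≠ 0) :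
    Integrable (fun η : ℝ => ‖(I * (η : ℂ) - z)⁻¹‖ ^ 2) := by
  simp_rw [norm_inv_I_mul_ofReal_sub_sq]
  exact (integrable_inv_sq_add_sq hz).comp_sub_right z.im

theorem integral_norm_inv_sq_le {z : ℂ} {h : ℝ} (hh : 0 < h) (hz : h ≤ |z.re|) :
    ∫ η : ℝ, ‖(I * (η : ℂ) - z)⁻¹‖ ^ 2 ≤ ∫ η : ℝ, (h ^ 2 + η ^ 2)⁻¹ := by
  have hz0 : z.re ≠ 0 := fun h0 => by rw [h0, abs_zero] at hz; linarith
  have hle : ∫ η : ℝ, ‖(I * (η : ℂ) - z)⁻¹‖ ^ 2 ≤ ∫ η : ℝ, (h ^ 2 + (η - z.im) ^ 2)⁻¹ := by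
    refine integral_mono (integrable_norm_inv_sq hz0)
      ((integrable_inv_sq_add_sq hh.ne').comp_sub_right z.im) fun η => ?_
    simp only [norm_inv_I_mul_ofReal_sub_sq]
    have : h ^ 2 ≤ z.re ^ 2 := by
      rw [← sq_abs z.re]; gcongr
    gcongr
  rwa [integral_sub_right_eq_self (fun η : ℝ => (h ^ 2 + η ^ 2)⁻¹) z.im] at hle

/-- The principal value of `∫ dη / (iη - z)` over the real line is `π` for `z` in the left
half plane. -/
theorem tendsto_integral_inv_of_re_neg {z : ℂ} (hz : z.re < 0) :
    Tendsto (fun ρ : ℝ => ∫ η in (-ρ)..ρ, (I * (η : ℂ) - z)⁻¹) atTop (𝓝 (Real.pi : ℂ)) := by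
  have hslit (η : ℝ) : I * (η : ℂ) - z ∈ slitPlane := by
    left; simpa using hz
  have hcont : Continuous fun η : ℝ => (I * (η : ℂ) - z)⁻¹ :=
    Continuous.inv₀ (by fun_prop) (I_mul_ofReal_sub_ne_zero hz.ne)
  have hder (η : ℝ) : HasDerivAt (fun η : ℝ => -I * log (I * (η : ℂ) - z))
      (I * (η : ℂ) - z)⁻¹ η := by
    have h1 : HasDerivAt (fun w : ℂ => I * w - z) I (η : ℂ) := by
      simpa using ((hasDerivAt_id (η : ℂ)).const_mul I).sub_const z
    have h2 := ((h1.clog (hslit η)).const_mul (-I)).comp_ofReal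
    convert h2 using 1
    rw [← mul_div_assoc, neg_mul, I_mul_I, neg_neg, one_div]
  have hint (ρ : ℝ) : ∫ η in (-ρ)..ρ, (I * (η : ℂ) - z)⁻¹
      = -I * log (I * (ρ : ℂ) - z) - -I * log (I * ((-ρ : ℝ) : ℂ) - z) :=
    intervalIntegral.integral_eq_sub_of_hasDerivAt (fun η _ => hder η)
      (hcont.intervalIntegrable _ _)
  have hlim (s : ℝ) (hs : (I * (s : ℂ)) ∈ slitPlane) :
      Tendsto (fun ρ : ℝ => log (I * (s : ℂ) - z * ((ρ⁻¹ : ℝ) : ℂ))) atTop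
        (𝓝 (log (I * (s : ℂ)))) := by
    have h0 : Tendsto (fun ρ : ℝ => ((ρ⁻¹ : ℝ) : ℂ)) atTop (𝓝 ((0 : ℝ) : ℂ)) :=
      (Complex.continuous_ofReal.tendsto 0).comp tendsto_inv_atTop_zero
    have h1 := (h0.const_mul z).const_sub (I * (s : ℂ))
    simp only [ofReal_zero, mul_zero, sub_zero] at h1
    exact h1.clog hs
  have h1 := hlim 1 (by right; simp)
  have h2 := hlim (-1) (by right; simp)
  have h3 := (h1.const_mul (-I)).sub (h2.const_mul (-I))
  have hval : -I * log (I * ((1 : ℝ) : ℂ)) - -I * log (I * ((-1 : ℝ) : ℂ)) = (Real.pi : ℂ) := by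
    have h4 : I * ((-1 : ℝ) : ℂ) = -I := by simp
    rw [h4, ofReal_one, mul_one, log_I, log_neg_I]
    linear_combination (-(Real.pi : ℂ)) * I_mul_I
  rw [hval] at h3
  refine h3.congr' ?_
  filter_upwards [eventually_gt_atTop 0] with ρ hρ
  have hρ' : (ρ : ℂ) ≠ 0 := by exact_mod_cast hρ.ne'
  have key (s : ℝ) : log (I * ((s * ρ : ℝ) : ℂ) - z)
      = (Real.log ρ : ℂ) + log (I * (s : ℂ) - z * ((ρ⁻¹ : ℝ) : ℂ)) := by
    have e : I * ((s * ρ : ℝ) : ℂ) - z = (ρ : ℂ) * (I * (s : ℂ) - z * ((ρ⁻¹ : ℝ) : ℂ)) := by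
      push_cast
      field_simp
    rw [← Complex.log_ofReal_mul hρ, ← e]
    intro h0
    rw [h0, mul_zero] at e
    exact I_mul_ofReal_sub_ne_zero hz.ne _ e
  rw [hint]
  have k1 := key 1
  have k2 := key (-1)
  rw [one_mul] at k1
  rw [neg_one_mul] at k2
  rw [k1, k2]
  ring

/-- The principal value of `∫ dη / (iη - z)` over the real line is `σ π` for `z` in the half plane
`σ Re z < 0`. -/
theorem tendsto_integral_inv {σ : ℝ} (hσ : σ ^ 2 = 1) {z : ℂ} (hz : σ * z.re < 0) :
    Tendsto (fun ρ : ℝ => ∫ η in (-ρ)..ρ, (I * (η : ℂ) - z)⁻¹) atTop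
      (𝓝 ((σ : ℂ) * (Real.pi : ℂ))) := by
  rcases mul_self_eq_one_iff.mp ((sq σ).symm.trans hσ) with rfl | rfl
  · simpa using tendsto_integral_inv_of_re_neg (by simpa using hz)
  · have h := (tendsto_integral_inv_of_re_neg (z := -z) (by simpa using hz)).neg
    rw [show ((-1 : ℝ) : ℂ) * (Real.pi : ℂ) = -(Real.pi : ℂ) by simp]
    refine h.congr fun ρ => ?_
    have h2 := intervalIntegral.integral_comp_neg (a := -ρ) (b := ρ)
      (fun η : ℝ => (I * (η : ℂ) - z)⁻¹)
    rw [neg_neg] at h2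
    rw [← h2, ← intervalIntegral.integral_neg]
    refine intervalIntegral.integral_congr fun η _ => ?_
    rw [← inv_neg]
    congr 1
    push_cast
    ring

theorem integrable_inv_mul_inv {z a : ℂ} (hz : z.re ≠ 0) (ha : a.re ≠ 0) :
    Integrable (fun η : ℝ => (I * (η : ℂ) - z)⁻¹ * (I * (η : ℂ) - a)⁻¹) := by
  have hcont (w : ℂ) (hw : w.re ≠ 0) : Continuous fun η : ℝ => (I * (η : ℂ) - w)⁻¹ :=
    Continuous.inv₀ (by fun_prop) (I_mul_ofReal_sub_ne_zero hw)
  refine Integrable.mono' ((integrable_norm_inv_sq hz).add (integrable_norm_inv_sq ha))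
    ((hcont z hz).mul (hcont a ha)).aestronglyMeasurable (ae_of_all _ fun η => ?_)
  rw [norm_mul]
  simp only [Pi.add_apply]
  nlinarith [sq_nonneg (‖(I * (η : ℂ) - z)⁻¹‖ - ‖(I * (η : ℂ) - a)⁻¹‖),
    sq_nonneg (‖(I * (η : ℂ) - z)⁻¹‖ + ‖(I * (η : ℂ) - a)⁻¹‖)]

theorem integral_inv_mul_inv_eq_zero {σ : ℝ} (hσ : σ ^ 2 = 1) {z a : ℂ} (hz : σ * z.re < 0)
    (ha : σ * a.re < 0) : ∫ η : ℝ, (I * (η : ℂ) - z)⁻¹ * (I * (η : ℂ) - a)⁻¹ = 0 := by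
  have hz0 : z.re ≠ 0 := fun h => by simp [h] at hz
  have ha0 : a.re ≠ 0 := fun h => by simp [h] at ha
  have hcont (w : ℂ) (hw : w.re ≠ 0) : Continuous fun η : ℝ => (I * (η : ℂ) - w)⁻¹ :=
    Continuous.inv₀ (by fun_prop) (I_mul_ofReal_sub_ne_zero hw)
  refine tendsto_nhds_unique (intervalIntegral_tendsto_integral (integrable_inv_mul_inv hz0 ha0)
    tendsto_neg_atTop_atBot tendsto_id) ?_
  simp only [id]
  by_cases hza : z = a
  · subst hza
    have hder (η : ℝ) : HasDerivAt (fun η : ℝ => I * (I * (η : ℂ) - z)⁻¹)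
        ((I * (η : ℂ) - z)⁻¹ * (I * (η : ℂ) - z)⁻¹) η := by
      have h1 : HasDerivAt (fun w : ℂ => I * w - z) I (η : ℂ) := by
        simpa using ((hasDerivAt_id (η : ℂ)).const_mul I).sub_const z
      have hne := I_mul_ofReal_sub_ne_zero hz0 η
      have h2 := ((h1.fun_inv hne).const_mul I).comp_ofReal
      convert h2 using 1
      field_simp
      rw [I_sq, neg_neg]
    have hlim : Tendsto (fun η : ℝ => I * (I * (η : ℂ) - z)⁻¹) (cocompact ℝ) (𝓝 0) := by
      rw [← mul_zero I]
      refine Tendsto.const_mul I (tendsto_inv₀_cobounded.comp ?_)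
      rw [← tendsto_norm_atTop_iff_cobounded]
      have h1 : Tendsto (fun η : ℝ => ‖η‖ - ‖z‖) (cocompact ℝ) atTop :=
        tendsto_atTop_add_const_right _ _ tendsto_norm_cocompact_atTop
      refine tendsto_atTop_mono (fun η => ?_) h1
      have := norm_sub_norm_le (I * (η : ℂ)) z
      simpa using this
    rw [cocompact_eq_atBot_atTop, tendsto_sup] at hlim
    have h := hlim.2.sub (hlim.1.comp tendsto_neg_atTop_atBot)
    rw [sub_zero] at h
    refine h.congr fun ρ => ?_
    exact (intervalIntegral.integral_eq_sub_of_hasDerivAt (fun η _ => hder η)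
      (((hcont z hz0).mul (hcont z hz0)).intervalIntegrable _ _)).symm
  · have hne : z - a ≠ 0 := sub_ne_zero.mpr hza
    have h := ((tendsto_integral_inv hσ hz).sub (tendsto_integral_inv hσ ha)).const_mul (z - a)⁻¹
    rw [sub_self, mul_zero] at h
    refine h.congr fun ρ => ?_
    rw [← intervalIntegral.integral_sub ((hcont z hz0).intervalIntegrable _ _)
      ((hcont a ha0).intervalIntegrable _ _), ← intervalIntegral.integral_const_mul]
    refine intervalIntegral.integral_congr fun η _ => ?_
    have h1 := I_mul_ofReal_sub_ne_zero hz0 η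
    have h2 := I_mul_ofReal_sub_ne_zero ha0 η
    field_simp
    ring

theorem isResolventAt_res {S : X →ₗ.[ℂ] X} {z : ℂ} (hz : z ∈ resolventSet S) :
    IsResolventAt S z (res S z) := by
  rw [res, dif_pos hz]
  exact Classical.choose_spec hz

theorem IsResolventAt.eq {S : X →ₗ.[ℂ] X} {z : ℂ} {R R' : X →L[ℂ] X} (h : IsResolventAt S z R)
    (h' : IsResolventAt S z R') : R = R' := by
  ext y
  obtain ⟨hy, e⟩ := h'.2 y
  have := h.1 ⟨R' y, hy⟩
  rw [e] at this
  exact this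

theorem IsResolventAt.injective {S : X →ₗ.[ℂ] X} {z : ℂ} {R : X →L[ℂ] X}
    (h : IsResolventAt S z R) : Function.Injective R := by
  refine (injective_iff_map_eq_zero R).mpr fun y hy => ?_
  obtain ⟨hd, e⟩ := h.2 y
  have h0 : (⟨R y, hd⟩ : S.domain) = 0 := Subtype.ext hy
  rw [h0, hy, S.map_zero, smul_zero, sub_zero] at e
  exact e.symm

/-- The first resolvent identity. -/
theorem IsResolventAt.sub_eq {S : X →ₗ.[ℂ] X} {z w : ℂ} {R R' : X →L[ℂ] X}
    (h : IsResolventAt S z R) (h' : IsResolventAt S w R') :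
    R - R' = (z - w) • (R * R') := by
  ext y
  obtain ⟨hy, e⟩ := h'.2 y
  have h1 := h.1 ⟨R' y, hy⟩
  have h2 : S ⟨R' y, hy⟩ = y + w • R' y := sub_eq_iff_eq_add.mp e
  rw [h2] at h1
  simp only [map_sub, map_add, map_smul] at h1
  simp only [sub_apply, smul_apply,
    mul_apply_eq_comp]
  linear_combination (norm := module) h1

theorem IsResolventAt.commute {S : X →ₗ.[ℂ] X} {z w : ℂ} {R R' : X →L[ℂ] X}
    (h : IsResolventAt S z R) (h' : IsResolventAt S w R') : Commute R R' := by
  by_cases hzw : z = w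
  · subst hzw
    rw [h.eq h']
  · have h1 := h.sub_eq h'
    have h2 := h'.sub_eq h
    have h3 : (z - w) • (R * R') = (z - w) • (R' * R) := by
      rw [← h1, ← neg_sub R' R, h2, ← neg_smul, neg_sub]
    exact smul_right_injective _ (sub_ne_zero.mpr hzw) h3

/-- An operator solving the resolvent equation with respect to a resolvent is a resolvent. -/
theorem IsResolventAt.of_eq_mul {S : X →ₗ.[ℂ] X} {a z : ℂ} {R B : X →L[ℂ] X}
    (h : IsResolventAt S a R) (hB : B = R * ((z - a) • B + 1)) (hc : Commute R B) :
    IsResolventAt S z B := by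
  have hB' : B = ((z - a) • B + 1) * R := by
    have : Commute R ((z - a) • B + 1) := (hc.smul_right _).add_right (Commute.one_right _)
    rw [← this.eq]; exact hB
  constructor
  · intro u
    have h1 := h.1 u
    have h2 := DFunLike.congr_fun hB' (S u - a • (u : X))
    simp only [mul_apply_eq_comp, add_apply,
      smul_apply, one_apply_eq_self, h1] at h2
    simp only [map_sub, map_smul] at h2 ⊢
    linear_combination (norm := module) h2
  · intro y
    obtain ⟨hy, e⟩ := h.2 (((z - a) • B + 1) y)
    have h2 : R (((z - a) • B + 1) y) = B y := (DFunLike.congr_fun hB y).symm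
    have hmem : B y ∈ S.domain := h2 ▸ hy
    refine ⟨hmem, ?_⟩
    have h3 : (⟨R (((z - a) • B + 1) y), hy⟩ : S.domain) = ⟨B y, hmem⟩ := Subtype.ext h2
    rw [h3, h2] at e
    simp only [add_apply, smul_apply,
      one_apply_eq_self] at e
    linear_combination (norm := module) e

/-- The Neumann series for the resolvent. -/
theorem IsResolventAt.neumann [CompleteSpace X] {S : X →ₗ.[ℂ] X} {a z : ℂ} {R : X →L[ℂ] X}
    (h : IsResolventAt S a R) (hz : ‖(z - a) • R‖ < 1) :
    IsResolventAt S z (R * Ring.inverse (1 - (z - a) • R)) := by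
  have hu := isUnit_one_sub_of_norm_lt_one hz
  have hc : Commute R (Ring.inverse (1 - (z - a) • R)) := by
    have h1 : Commute R (1 - (z - a) • R) :=
      (Commute.one_right R).sub_right ((Commute.refl R).smul_right _)
    obtain ⟨u, hu'⟩ := hu
    rw [← hu'] at h1 ⊢
    rw [Ring.inverse_unit]
    exact h1.units_inv_right
  refine h.of_eq_mul ?_ ((Commute.refl R).mul_right hc)
  congr 1
  have := Ring.mul_inverse_cancel _ hu
  rw [sub_mul, one_mul, smul_mul_assoc] at this
  exact sub_eq_iff_eq_add'.mp this

theorem mem_resolventSet_of_norm_lt [CompleteSpace X] {S : X →ₗ.[ℂ] X} {a z : ℂ}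
    (ha : a ∈ resolventSet S) (hz : ‖z - a‖ * ‖res S a‖ < 1) : z ∈ resolventSet S :=
  ⟨_, (isResolventAt_res ha).neumann (by rwa [norm_smul])⟩

theorem eventually_norm_sub_mul_lt (a : ℂ) (M : ℝ) : ∀ᶠ z in 𝓝 a, ‖z - a‖ * M < 1 := by
  have hc : Tendsto (fun z : ℂ => ‖z - a‖ * M) (𝓝 a) (𝓝 (‖a - a‖ * M)) :=
    Continuous.tendsto (by fun_prop) a
  rw [sub_self, norm_zero, zero_mul] at hc
  exact hc.eventually_lt_const one_pos

theorem differentiableAt_res [CompleteSpace X] {S : X →ₗ.[ℂ] X} {a : ℂ}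
    (ha : a ∈ resolventSet S) : DifferentiableAt ℂ (res S) a := by
  have hd : DifferentiableAt ℂ (fun z => res S a * Ring.inverse (1 - (z - a) • res S a)) a := by
    refine DifferentiableAt.const_mul (DifferentiableAt.inverse (by fun_prop) ?_) _
    simp
  refine hd.congr_of_eventuallyEq ?_
  filter_upwards [eventually_norm_sub_mul_lt a ‖res S a‖] with z hz
  exact (isResolventAt_res (mem_resolventSet_of_norm_lt ha hz)).eq
    ((isResolventAt_res ha).neumann (by rwa [norm_smul]))

theorem norm_res_le_two_mul {S : X →ₗ.[ℂ] X} {a z : ℂ} (ha : a ∈ resolventSet S)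
    (hz : z ∈ resolventSet S) (hza : ‖z - a‖ * ‖res S a‖ ≤ 1 / 2) :
    ‖res S z‖ ≤ 2 * ‖res S a‖ := by
  have h := (isResolventAt_res hz).sub_eq (isResolventAt_res ha)
  have h1 : ‖res S z‖ ≤ ‖res S a‖ + ‖res S z - res S a‖ := norm_le_insert' _ _
  have h2 : ‖res S z - res S a‖ ≤ ‖z - a‖ * (‖res S z‖ * ‖res S a‖) := by
    rw [h, norm_smul]
    gcongr
    exact norm_mul_le _ _
  nlinarith [norm_nonneg (res S z), norm_nonneg (res S a)]

/-- A solution `B` of `(S - z) B = B (S - z) = Q` gives a resolvent of the part of `S` in the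
range of `Q`. -/
theorem IsResolventAt.isPartResolventAt {S : X →ₗ.[ℂ] X} {a z : ℂ} {R B Q : X →L[ℂ] X}
    (h : IsResolventAt S a R) (hQ : IsIdempotentElem Q) (hRQ : Commute R Q) (hBQ : Commute B Q)
    (hRB : Commute R B) (hB : B = R * ((z - a) • B + Q)) :
    IsPartResolventAt S Q z (Q * B) := by
  have hB' : B = ((z - a) • B + Q) * R := by
    have : Commute R ((z - a) • B + Q) := (hRB.smul_right _).add_right hRQ
    rw [← this.eq]; exact hB
  have hQQ (y : X) : Q (Q y) = Q y := DFunLike.congr_fun hQ y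
  have hQB (y : X) : Q (B y) = B (Q y) := (DFunLike.congr_fun hBQ.eq y).symm
  refine ⟨fun y => ?_, fun y => ?_, fun y => ?_, fun u hu => ?_⟩
  · simp only [mul_apply_eq_comp, hQB, hQQ]
  · simp only [mul_apply_eq_comp, hQQ]
  · obtain ⟨hy, e⟩ := h.2 (((z - a) • B + Q) (Q y))
    have h2 : R (((z - a) • B + Q) (Q y)) = (Q * B) y := by
      rw [mul_apply_eq_comp, hQB]
      exact (DFunLike.congr_fun hB (Q y)).symm
    have hmem : (Q * B) y ∈ S.domain := h2 ▸ hy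
    refine ⟨hmem, ?_⟩
    have h3 : (⟨R (((z - a) • B + Q) (Q y)), hy⟩ : S.domain) = ⟨(Q * B) y, hmem⟩ :=
      Subtype.ext h2
    rw [h3, h2] at e
    simp only [add_apply, smul_apply, hQQ, ← hQB] at e
    have h4 : (Q * B) y = Q (B y) := rfl
    linear_combination (norm := module) e + (z - a) • h4.symm
  · have h1 := h.1 u
    have h2 := DFunLike.congr_fun hB' (S u - a • (u : X))
    simp only [mul_apply_eq_comp, add_apply,
      smul_apply, h1, hu] at h2
    have h3 : B (S u - z • (u : X)) = u := by
      simp only [map_sub, map_smul] at h2 ⊢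
      linear_combination (norm := module) h2
    rw [mul_apply_eq_comp, h3, hu]

/-- Resolvents of the two parts of a decomposed operator add up to a resolvent. -/
theorem DecomposedBy.isResolventAt_add {S : X →ₗ.[ℂ] X} {Qp Qm Rp Rm : X →L[ℂ] X} {z : ℂ}
    (hd : DecomposedBy S Qp Qm) (hp : IsPartResolventAt S Qp z Rp)
    (hm : IsPartResolventAt S Qm z Rm) : IsResolventAt S z (Rp + Rm) := by
  obtain ⟨hsum, hip, him, hdp, hdm⟩ := hd
  have hsum' (y : X) : Qp y + Qm y = y := DFunLike.congr_fun hsum y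
  have aux {Q R : X →L[ℂ] X} (hi : IsIdempotentElem Q)
      (hQ : ∀ u : S.domain, ∃ hp : Q (u : X) ∈ S.domain, S ⟨Q (u : X), hp⟩ = Q (S u))
      (hR : IsPartResolventAt S Q z R) (u : S.domain) : R (S u - z • (u : X)) = Q u := by
    obtain ⟨hmem, e⟩ := hQ u
    have h1 := hR.2.2.2 ⟨Q u, hmem⟩ (DFunLike.congr_fun hi (u : X))
    rw [e] at h1
    rw [← hR.1, map_sub, map_smul]
    exact h1
  refine ⟨fun u => ?_, fun y => ?_⟩
  · rw [add_apply, aux hip hdp hp u, aux him hdm hm u, hsum']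
  · obtain ⟨h1, e1⟩ := hp.2.2.1 y
    obtain ⟨h2, e2⟩ := hm.2.2.1 y
    refine ⟨S.domain.add_mem h1 h2, ?_⟩
    have h3 := S.map_add ⟨Rp y, h1⟩ ⟨Rm y, h2⟩
    calc _ = S (⟨Rp y, h1⟩ + ⟨Rm y, h2⟩) - z • (Rp y + Rm y) := rfl
      _ = (S ⟨Rp y, h1⟩ - z • Rp y) + (S ⟨Rm y, h2⟩ - z • Rm y) := by
        rw [h3, smul_add]; abel
      _ = y := by rw [e1, e2, hsum']

theorem IsResolventAt.apply_of_commute {S : X →ₗ.[ℂ] X} {R Q : X →L[ℂ] X} {a : ℂ}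
    (h : IsResolventAt S a R) (hQ : Commute R Q) (u : S.domain) :
    ∃ hp : Q (u : X) ∈ S.domain, S ⟨Q (u : X), hp⟩ = Q (S u) := by
  have h1 := h.1 u
  obtain ⟨hy, e⟩ := h.2 (Q (S u - a • (u : X)))
  have h2 : R (Q (S u - a • (u : X))) = Q u := by
    exact (DFunLike.congr_fun hQ.eq _).trans (congrArg Q h1)
  have hmem : Q (u : X) ∈ S.domain := h2 ▸ hy
  refine ⟨hmem, ?_⟩
  have h3 : (⟨R (Q (S u - a • (u : X))), hy⟩ : S.domain) = ⟨Q u, hmem⟩ := Subtype.ext h2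
  rw [h3, h2, map_sub, map_smul] at e
  exact sub_left_injective e


section AxisIntegral

variable {E : Type*} [NormedAddCommGroup E] [NormedSpace ℂ E]

theorem continuous_inv_I_mul_ofReal_sub {z : ℂ} (hz : z.re ≠ 0) :
    Continuous fun η : ℝ => (I * (η : ℂ) - z)⁻¹ :=
  Continuous.inv₀ (by fun_prop) (I_mul_ofReal_sub_ne_zero hz)

/-- The integral `(2π)⁻¹ ∫ k(η) / ((iη - z) (iη - a)) dη` of a function on the imaginary axis. -/
def axisIntegral (k : ℝ → E) (z a : ℂ) : E :=
  (2 * Real.pi : ℂ)⁻¹ • ∫ η : ℝ, ((I * (η : ℂ) - z)⁻¹ * (I * (η : ℂ) - a)⁻¹) • k η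

variable {k : ℝ → E} {M : ℝ} (hk : Continuous k) (hM : ∀ η, ‖k η‖ ≤ M)

theorem norm_axisIntegrand_le (hM : ∀ η, ‖k η‖ ≤ M) (z a : ℂ) (η : ℝ) :
    ‖((I * (η : ℂ) - z)⁻¹ * (I * (η : ℂ) - a)⁻¹) • k η‖ ≤
      M / 2 * (‖(I * (η : ℂ) - z)⁻¹‖ ^ 2 + ‖(I * (η : ℂ) - a)⁻¹‖ ^ 2) := by
  have hM0 : 0 ≤ M := (norm_nonneg _).trans (hM 0)
  rw [norm_smul, norm_mul]
  set u := ‖(I * (η : ℂ) - z)⁻¹‖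
  set v := ‖(I * (η : ℂ) - a)⁻¹‖
  have h0 : 0 ≤ u * v := by positivity
  calc u * v * ‖k η‖ ≤ u * v * M := mul_le_mul_of_nonneg_left (hM η) h0
    _ ≤ M / 2 * (u ^ 2 + v ^ 2) := by nlinarith [mul_nonneg hM0 (sq_nonneg (u - v))]

include hk hM in
theorem integrable_axisIntegrand {z a : ℂ} (hz : z.re ≠ 0) (ha : a.re ≠ 0) :
    Integrable fun η : ℝ => ((I * (η : ℂ) - z)⁻¹ * (I * (η : ℂ) - a)⁻¹) • k η :=
  Integrable.mono' (((integrable_norm_inv_sq hz).add (integrable_norm_inv_sq ha)).const_mul (M / 2))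
    (((continuous_inv_I_mul_ofReal_sub hz).mul
      (continuous_inv_I_mul_ofReal_sub ha)).smul hk).aestronglyMeasurable
    (ae_of_all _ fun η => norm_axisIntegrand_le hM z a η)

theorem norm_axisIntegral_le (hM : ∀ η, ‖k η‖ ≤ M) {z a : ℂ} {h : ℝ} (hh : 0 < h)
    (hz : h ≤ |z.re|) (ha : h ≤ |a.re|) :
    ‖axisIntegral k z a‖ ≤ ‖(2 * Real.pi : ℂ)⁻¹‖ * (M * ∫ η : ℝ, (h ^ 2 + η ^ 2)⁻¹) := by
  have hM0 : 0 ≤ M := (norm_nonneg _).trans (hM 0)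
  have hz0 : z.re ≠ 0 := abs_pos.mp (hh.trans_le hz)
  have ha0 : a.re ≠ 0 := abs_pos.mp (hh.trans_le ha)
  rw [axisIntegral, norm_smul]
  refine mul_le_mul_of_nonneg_left ?_ (norm_nonneg _)
  refine (norm_integral_le_of_norm_le
    (((integrable_norm_inv_sq hz0).add (integrable_norm_inv_sq ha0)).const_mul (M / 2))
    (ae_of_all _ fun η => norm_axisIntegrand_le hM z a η)).trans ?_
  rw [integral_const_mul]
  simp only [Pi.add_apply]
  rw [integral_add (integrable_norm_inv_sq hz0) (integrable_norm_inv_sq ha0)]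
  nlinarith [mul_le_mul_of_nonneg_left (integral_norm_inv_sq_le hh hz) hM0,
    mul_le_mul_of_nonneg_left (integral_norm_inv_sq_le hh ha) hM0]

include hk hM in
theorem differentiableAt_axisIntegral {z a : ℂ} (hz : z.re ≠ 0) (ha : a.re ≠ 0) :
    DifferentiableAt ℂ (fun w => axisIntegral k w a) z := by
  have hM0 : 0 ≤ M := (norm_nonneg _).trans (hM 0)
  have hd : 0 < |z.re| / 2 := half_pos (abs_pos.mpr hz)
  have hball (w : ℂ) (hw : w ∈ Metric.ball z (|z.re| / 2)) (η : ℝ) :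
      w.re ≠ 0 ∧ ‖(I * (η : ℂ) - w)⁻¹‖ ≤ 2 * ‖(I * (η : ℂ) - z)⁻¹‖ := by
    rw [Metric.mem_ball, dist_eq_norm] at hw
    have h1 : |z.re| ≤ ‖I * (η : ℂ) - z‖ := by
      simpa using Complex.abs_re_le_norm (I * (η : ℂ) - z)
    have h2 : ‖I * (η : ℂ) - z‖ ≤ ‖I * (η : ℂ) - w‖ + ‖w - z‖ := by
      rw [← sub_add_sub_cancel (I * (η : ℂ)) w z]; exact norm_add_le _ _
    have h3 : 0 < ‖I * (η : ℂ) - z‖ := (abs_pos.mpr hz).trans_le h1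
    have h4 : ‖I * (η : ℂ) - z‖ / 2 ≤ ‖I * (η : ℂ) - w‖ := by linarith
    constructor
    · intro h0
      have h5 := Complex.abs_re_le_norm (w - z)
      rw [sub_re, h0, zero_sub, abs_neg] at h5
      linarith
    · rw [norm_inv, norm_inv]
      calc ‖I * (η : ℂ) - w‖⁻¹ ≤ (‖I * (η : ℂ) - z‖ / 2)⁻¹ := by gcongr
        _ = 2 * ‖I * (η : ℂ) - z‖⁻¹ := by rw [inv_div]; rfl
  have key := hasDerivAt_integral_of_dominated_loc_of_deriv_le (μ := volume) (𝕜 := ℂ)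
    (F := fun w (η : ℝ) => ((I * (η : ℂ) - w)⁻¹ * (I * (η : ℂ) - a)⁻¹) • k η)
    (F' := fun w (η : ℝ) => ((I * (η : ℂ) - w)⁻¹ ^ 2 * (I * (η : ℂ) - a)⁻¹) • k η)
    (bound := fun η : ℝ => 4 * |a.re|⁻¹ * M * ‖(I * (η : ℂ) - z)⁻¹‖ ^ 2)
    (Metric.ball_mem_nhds z hd) ?_ (integrable_axisIntegrand hk hM hz ha) ?_ ?_ ?_ ?_
  · exact key.2.differentiableAt.const_smul _
  · filter_upwards [Metric.ball_mem_nhds z hd] with w hw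
    exact (integrable_axisIntegrand hk hM (hball w hw 0).1 ha).aestronglyMeasurable
  · exact ((((continuous_inv_I_mul_ofReal_sub hz).pow 2).mul
      (continuous_inv_I_mul_ofReal_sub ha)).smul hk).aestronglyMeasurable
  · refine ae_of_all _ fun η w hw => ?_
    rw [norm_smul, norm_mul, norm_pow]
    calc ‖(I * (η : ℂ) - w)⁻¹‖ ^ 2 * ‖(I * (η : ℂ) - a)⁻¹‖ * ‖k η‖
        ≤ (2 * ‖(I * (η : ℂ) - z)⁻¹‖) ^ 2 * |a.re|⁻¹ * M := by
          gcongr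
          · exact (hball w hw η).2
          · exact norm_inv_I_mul_ofReal_sub_le ha η
          · exact hM η
      _ = _ := by ring
  · exact (integrable_norm_inv_sq hz).const_mul _
  · refine ae_of_all _ fun η w hw => ?_
    have hne := I_mul_ofReal_sub_ne_zero (hball w hw η).1 η
    have h1 : HasDerivAt (fun w : ℂ => I * (η : ℂ) - w) (-1) w := by
      simpa using (hasDerivAt_id w).const_sub (I * (η : ℂ))
    have h2 := ((h1.fun_inv hne).mul_const (I * (η : ℂ) - a)⁻¹).smul_const (k η)
    convert h2 using 3
    rw [neg_neg, inv_pow, one_div]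

end AxisIntegral

theorem commute_axisIntegral {k : ℝ → X →L[ℂ] X} {M : ℝ} (hk : Continuous k)
    (hM : ∀ η, ‖k η‖ ≤ M) {z a : ℂ} (hz : z.re ≠ 0) (ha : a.re ≠ 0) {B : X →L[ℂ] X}
    (hB : ∀ η, Commute B (k η)) : Commute B (axisIntegral k z a) := by
  have hi := integrable_axisIntegrand hk hM hz ha
  refine Commute.smul_right ?_ _
  rw [commute_iff_eq, ← integral_const_mul_of_integrable hi, ← integral_mul_const_of_integrable hi]
  congr 1
  ext1 η
  exact ((hB η).smul_right _).eq

section Dichotomy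

variable {S : X →ₗ.[ℂ] X} {M : ℝ}

theorem continuous_res_axis [CompleteSpace X] (hres : ∀ η : ℝ, I * (η : ℂ) ∈ resolventSet S) :
    Continuous fun η : ℝ => res S (I * (η : ℂ)) := by
  refine continuous_iff_continuousAt.mpr fun η => ?_
  exact ContinuousAt.comp (f := fun η : ℝ => I * (η : ℂ))
    (differentiableAt_res (hres η)).continuousAt (by fun_prop)

theorem res_mul_res_axis (hres : ∀ η : ℝ, I * (η : ℂ) ∈ resolventSet S) {a : ℂ}
    (ha : a ∈ resolventSet S) (ha0 : a.re ≠ 0) (η : ℝ) :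
    res S a * res S (I * (η : ℂ)) = (I * (η : ℂ) - a)⁻¹ • (res S (I * (η : ℂ)) - res S a) := by
  have h := (isResolventAt_res (hres η)).sub_eq (isResolventAt_res ha)
  rw [h, smul_smul, inv_mul_cancel₀ (I_mul_ofReal_sub_ne_zero ha0 η), one_smul]
  exact ((isResolventAt_res (hres η)).commute (isResolventAt_res ha)).eq.symm

theorem smul_res_mul_axisIntegral [CompleteSpace X]
    (hres : ∀ η : ℝ, I * (η : ℂ) ∈ resolventSet S)
    (hM : ∀ η : ℝ, ‖res S (I * (η : ℂ))‖ ≤ M) {σ : ℝ} (hσ : σ ^ 2 = 1) {z a : ℂ}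
    (hz : σ * z.re < 0) (ha : σ * a.re < 0) (haS : a ∈ resolventSet S) :
    (z - a) • (res S a * axisIntegral (fun η : ℝ => res S (I * (η : ℂ))) z a) =
      axisIntegral (fun η : ℝ => res S (I * (η : ℂ))) z a
        - axisIntegral (fun η : ℝ => res S (I * (η : ℂ))) a a := by
  have hz0 : z.re ≠ 0 := fun h => by simp [h] at hz
  have ha0 : a.re ≠ 0 := fun h => by simp [h] at ha
  have hk := continuous_res_axis hres
  have hiz := integrable_axisIntegrand hk hM hz0 ha0
  have hia := integrable_axisIntegrand hk hM ha0 ha0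
  have hsz : Integrable fun η : ℝ => ((I * (η : ℂ) - z)⁻¹ * (I * (η : ℂ) - a)⁻¹) • res S a :=
    (integrable_inv_mul_inv hz0 ha0).smul_const _
  have hsa : Integrable fun η : ℝ => ((I * (η : ℂ) - a)⁻¹ * (I * (η : ℂ) - a)⁻¹) • res S a :=
    (integrable_inv_mul_inv ha0 ha0).smul_const _
  have hint : (z - a) • (res S a * ∫ η : ℝ, ((I * (η : ℂ) - z)⁻¹ * (I * (η : ℂ) - a)⁻¹) •
        res S (I * (η : ℂ))) =
      (∫ η : ℝ, ((I * (η : ℂ) - z)⁻¹ * (I * (η : ℂ) - a)⁻¹) • res S (I * (η : ℂ))) -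
      (∫ η : ℝ, ((I * (η : ℂ) - a)⁻¹ * (I * (η : ℂ) - a)⁻¹) • res S (I * (η : ℂ))) := by
    have h0 : (∫ η : ℝ, ((I * (η : ℂ) - z)⁻¹ * (I * (η : ℂ) - a)⁻¹) • res S a) -
        ∫ η : ℝ, ((I * (η : ℂ) - a)⁻¹ * (I * (η : ℂ) - a)⁻¹) • res S a = 0 := by
      rw [integral_smul_const, integral_smul_const, integral_inv_mul_inv_eq_zero hσ hz ha,
        integral_inv_mul_inv_eq_zero hσ ha ha, zero_smul, sub_zero]
    refine Eq.trans ?_ (sub_zero _)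
    have h1 := integral_sub (hiz.sub hia) (hsz.sub hsa)
    simp only [Pi.sub_apply] at h1
    rw [← h0, ← integral_sub hiz hia, ← integral_sub hsz hsa, ← h1,
      ← integral_const_mul_of_integrable hiz, ← integral_smul]
    congr 1
    ext1 η
    have e1 := I_mul_ofReal_sub_ne_zero hz0 η
    have e2 := I_mul_ofReal_sub_ne_zero ha0 η
    rw [mul_smul_comm, res_mul_res_axis hres haS ha0]
    have e3 : (z - a) * ((I * (η : ℂ) - z)⁻¹ * (I * (η : ℂ) - a)⁻¹ * (I * (η : ℂ) - a)⁻¹)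
        = (I * (η : ℂ) - z)⁻¹ * (I * (η : ℂ) - a)⁻¹
          - (I * (η : ℂ) - a)⁻¹ * (I * (η : ℂ) - a)⁻¹ := by
      field_simp
      ring
    rw [smul_smul, smul_smul, mul_assoc, e3]
    module
  simp only [axisIntegral]
  rw [← smul_sub, ← hint, mul_smul_comm, smul_comm]

/-- The principal value integral `A` of the resolvent satisfies `R(a)² A = 2 G(a, a) - σ R(a)²`. -/
theorem res_mul_res_mul_pv [CompleteSpace X]
    (hres : ∀ η : ℝ, I * (η : ℂ) ∈ resolventSet S)
    (hM : ∀ η : ℝ, ‖res S (I * (η : ℂ))‖ ≤ M) {A : X →L[ℂ] X}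
    (hA : ∀ x : X, Tendsto
      (fun ρ : ℝ => (Real.pi)⁻¹ • ∫ η in (-ρ)..ρ, res S (I * (η : ℂ)) x) atTop (𝓝 (A x)))
    {σ : ℝ} (hσ : σ ^ 2 = 1) {a : ℂ} (ha : σ * a.re < 0) (haS : a ∈ resolventSet S) :
    res S a * (res S a * A) = (2 : ℂ) • axisIntegral (fun η : ℝ => res S (I * (η : ℂ))) a a
      - (σ : ℂ) • (res S a * res S a) := by
  have ha0 : a.re ≠ 0 := fun h => by simp [h] at ha
  have hk := continuous_res_axis hres
  have hia := integrable_axisIntegrand hk hM ha0 ha0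
  have hsa : Integrable fun η : ℝ => ((I * (η : ℂ) - a)⁻¹ * (I * (η : ℂ) - a)⁻¹) • res S a :=
    (integrable_inv_mul_inv ha0 ha0).smul_const _
  have hpi : (Real.pi : ℂ) ≠ 0 := by exact_mod_cast Real.pi_ne_zero
  ext x
  have hl : Tendsto (fun ρ : ℝ => (Real.pi : ℂ)⁻¹ •
      (((∫ η in (-ρ)..ρ, ((I * (η : ℂ) - a)⁻¹ * (I * (η : ℂ) - a)⁻¹) • res S (I * (η : ℂ)))
        - (∫ η in (-ρ)..ρ, ((I * (η : ℂ) - a)⁻¹ * (I * (η : ℂ) - a)⁻¹) • res S a)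
        - (∫ η in (-ρ)..ρ, (I * (η : ℂ) - a)⁻¹) • (res S a * res S a)) x)) atTop
      (𝓝 (((2 : ℂ) • axisIntegral (fun η : ℝ => res S (I * (η : ℂ))) a a
      - (σ : ℂ) • (res S a * res S a)) x)) := by
    have t1 := intervalIntegral_tendsto_integral hia tendsto_neg_atTop_atBot tendsto_id
    have t2 := intervalIntegral_tendsto_integral hsa tendsto_neg_atTop_atBot tendsto_id
    have t3 := (tendsto_integral_inv hσ ha).smul_const (res S a * res S a)
    rw [integral_smul_const, integral_inv_mul_inv_eq_zero hσ ha ha, zero_smul] at t2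
    have t4 := ((ContinuousLinearMap.apply ℂ X x).continuous.tendsto _).comp
      (((t1.sub t2).sub t3).const_smul (Real.pi : ℂ)⁻¹)
    have c1 : (2 : ℂ) * (2 * Real.pi : ℂ)⁻¹ = (Real.pi : ℂ)⁻¹ := by field_simp
    have c2 : (Real.pi : ℂ)⁻¹ * ((σ : ℂ) * Real.pi) = σ := by field_simp
    rw [sub_zero, smul_sub, smul_smul, c2, ← c1, mul_smul] at t4
    rw [c1] at t4
    exact t4
  have hr : Tendsto (fun ρ : ℝ => res S a (res S a
      ((Real.pi)⁻¹ • ∫ η in (-ρ)..ρ, res S (I * (η : ℂ)) x))) atTop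
      (𝓝 (res S a (res S a (A x)))) :=
    (((res S a).continuous.comp (res S a).continuous).tendsto _).comp (hA x)
  refine tendsto_nhds_unique hr (hl.congr fun ρ => ?_)
  have hc := (continuous_inv_I_mul_ofReal_sub ha0)
  have i0 := hk.intervalIntegrable (μ := volume) (-ρ) ρ
  have i1 : IntervalIntegrable (fun η : ℝ =>
      ((I * (η : ℂ) - a)⁻¹ * (I * (η : ℂ) - a)⁻¹) • res S (I * (η : ℂ))) volume (-ρ) ρ :=
    ((hc.mul hc).smul hk).intervalIntegrable _ _
  have i2 : IntervalIntegrable (fun η : ℝ =>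
      ((I * (η : ℂ) - a)⁻¹ * (I * (η : ℂ) - a)⁻¹) • res S a) volume (-ρ) ρ :=
    ((hc.mul hc).smul continuous_const).intervalIntegrable _ _
  have i3 : IntervalIntegrable (fun η : ℝ =>
      (I * (η : ℂ) - a)⁻¹ • (res S a * res S a)) volume (-ρ) ρ :=
    (hc.smul continuous_const).intervalIntegrable _ _
  have hmul : res S a * res S a * ∫ η in (-ρ)..ρ, res S (I * (η : ℂ)) =
      (∫ η in (-ρ)..ρ, ((I * (η : ℂ) - a)⁻¹ * (I * (η : ℂ) - a)⁻¹) • res S (I * (η : ℂ)))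
        - (∫ η in (-ρ)..ρ, ((I * (η : ℂ) - a)⁻¹ * (I * (η : ℂ) - a)⁻¹) • res S a)
        - (∫ η in (-ρ)..ρ, (I * (η : ℂ) - a)⁻¹) • (res S a * res S a) := by
    have e3 := intervalIntegral.integral_smul_const (μ := volume) (a := -ρ) (b := ρ)
      (fun η : ℝ => (I * (η : ℂ) - a)⁻¹) (res S a * res S a)
    rw [← e3, ← intervalIntegral.integral_sub i1 i2,
      ← intervalIntegral.integral_sub (i1.sub i2) i3]
    have := ((ContinuousLinearMap.mul ℂ (X →L[ℂ] X)) (res S a * res S a)).intervalIntegral_comp_comm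
      i0
    simp only [ContinuousLinearMap.mul_apply'] at this
    rw [← this]
    refine intervalIntegral.integral_congr fun η _ => ?_
    rw [mul_assoc, res_mul_res_axis hres haS ha0, mul_smul_comm, mul_sub,
      res_mul_res_axis hres haS ha0]
    module
  rw [← hmul, mul_apply_eq_comp, mul_apply_eq_comp, ContinuousLinearMap.intervalIntegral_apply i0]
  rw [← ofReal_inv, ← map_smul, ← map_smul, RCLike.real_smul_eq_coe_smul (K := ℂ)]
  rfl

end Dichotomy

theorem exists_norm_res_axis_le [CompleteSpace X] {S : X →ₗ.[ℂ] X}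
    (hres : ∀ η : ℝ, I * (η : ℂ) ∈ resolventSet S)
    (hdecay : Tendsto (fun η : ℝ => ‖res S (I * (η : ℂ))‖) (cocompact ℝ) (𝓝 0)) :
    ∃ M : ℝ, ∀ η : ℝ, ‖res S (I * (η : ℂ))‖ ≤ M := by
  obtain ⟨K, hK, hKs⟩ := mem_cocompact.mp (hdecay.eventually_lt_const one_pos)
  obtain ⟨C, hC⟩ := hK.exists_bound_of_continuousOn (continuous_res_axis hres).continuousOn
  refine ⟨max C 1, fun η => ?_⟩
  by_cases h : η ∈ K
  · exact (hC η h).trans (le_max_left _ _)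
  · exact (le_of_lt (hKs h)).trans (le_max_right _ _)

theorem commute_pv [CompleteSpace X] {S : X →ₗ.[ℂ] X}
    (hres : ∀ η : ℝ, I * (η : ℂ) ∈ resolventSet S) {A : X →L[ℂ] X}
    (hA : ∀ x : X, Tendsto
      (fun ρ : ℝ => (Real.pi)⁻¹ • ∫ η in (-ρ)..ρ, res S (I * (η : ℂ)) x) atTop (𝓝 (A x)))
    {B : X →L[ℂ] X} (hB : ∀ η : ℝ, Commute B (res S (I * (η : ℂ)))) : Commute B A := by
  ext x
  refine tendsto_nhds_unique ((B.continuous.tendsto _).comp (hA x)) ((hA (B x)).congr fun ρ => ?_)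
  have hi : IntervalIntegrable (fun η : ℝ => res S (I * (η : ℂ)) x) volume (-ρ) ρ :=
    ((continuous_res_axis hres).clm_apply continuous_const).intervalIntegrable _ _
  rw [Function.comp_apply, ContinuousLinearMap.map_smul_of_tower, ← B.intervalIntegral_comp_comm hi]
  congr 1
  refine intervalIntegral.integral_congr fun η _ => ?_
  exact (DFunLike.congr_fun (hB η).eq x).symm

/-- The operator `(1 + σ A) / 2`, which is one of the spectral projections when `σ = ±1` and `A` is
the principal value integral of the resolvent. -/
def signProj (A : X →L[ℂ] X) (σ : ℝ) : X →L[ℂ] X := (2 : ℂ)⁻¹ • (1 + (σ : ℂ) • A)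

theorem Commute.signProj {A B : X →L[ℂ] X} (h : Commute B A) (σ : ℝ) :
    Commute B (signProj A σ) :=
  ((Commute.one_right B).add_right (h.smul_right _)).smul_right _

theorem signProj_one_add_signProj_neg_one (A : X →L[ℂ] X) :
    signProj A 1 + signProj A (-1) = 1 := by
  simp only [signProj, ofReal_neg, ofReal_one]
  module

theorem signProj_one_sub_signProj_neg_one (A : X →L[ℂ] X) :
    signProj A 1 - signProj A (-1) = A := by
  simp only [signProj, ofReal_neg, ofReal_one]
  module

section HalfPlane

variable [CompleteSpace X] {S : X →ₗ.[ℂ] X} {M : ℝ} {A : X →L[ℂ] X}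
  (hres : ∀ η : ℝ, I * (η : ℂ) ∈ resolventSet S)
  (hM : ∀ η : ℝ, ‖res S (I * (η : ℂ))‖ ≤ M)
  (hA : ∀ x : X, Tendsto
    (fun ρ : ℝ => (Real.pi)⁻¹ • ∫ η in (-ρ)..ρ, res S (I * (η : ℂ)) x) atTop (𝓝 (A x)))

/-- The operator `R(z) R(a) Q`, written as an integral over the imaginary axis which makes sense
for all `z` in the half plane `σ Re z < 0`. -/
def halfPlaneOp (S : X →ₗ.[ℂ] X) (σ : ℝ) (a z : ℂ) : X →L[ℂ] X :=
  (σ : ℂ) • axisIntegral (fun η : ℝ => res S (I * (η : ℂ))) z a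

include hres hA in
theorem commute_res_signProj {w : ℂ} (hw : w ∈ resolventSet S) (σ : ℝ) :
    Commute (res S w) (signProj A σ) :=
  Commute.signProj (commute_pv hres hA fun η =>
    (isResolventAt_res hw).commute (isResolventAt_res (hres η))) σ

include hres hM in
theorem commute_halfPlaneOp {σ : ℝ} {a z : ℂ} (hz : σ * z.re < 0) (ha : σ * a.re < 0)
    {B : X →L[ℂ] X} (hB : ∀ η : ℝ, Commute B (res S (I * (η : ℂ)))) :
    Commute B (halfPlaneOp S σ a z) :=
  (commute_axisIntegral (continuous_res_axis hres) hM (right_ne_zero_of_mul hz.ne)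
    (right_ne_zero_of_mul ha.ne) hB).smul_right _

include hres hM hA in
theorem halfPlaneOp_eq {σ : ℝ} (hσ : σ ^ 2 = 1) {a z : ℂ} (hz : σ * z.re < 0)
    (ha : σ * a.re < 0) (haS : a ∈ resolventSet S) :
    halfPlaneOp S σ a z = res S a * ((z - a) • halfPlaneOp S σ a z + res S a * signProj A σ) := by
  have h1 := smul_res_mul_axisIntegral hres hM hσ hz ha haS
  have h2 := res_mul_res_mul_pv hres hM hA hσ ha haS
  have h3 : (σ : ℂ) * σ = 1 := by rw [← sq]; exact_mod_cast hσ
  have h4 : res S a * (res S a * signProj A σ) =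
      (σ : ℂ) • axisIntegral (fun η : ℝ => res S (I * (η : ℂ))) a a := by
    rw [signProj, mul_smul_comm, mul_smul_comm, mul_add, mul_add, mul_one, mul_smul_comm,
      mul_smul_comm, h2, smul_sub, smul_smul, smul_smul (σ : ℂ) (σ : ℂ), h3]
    module
  rw [mul_add, h4, halfPlaneOp, mul_smul_comm, mul_smul_comm, smul_comm, h1]
  module

include hres hM hA in
theorem halfPlaneOp_eq_res_mul {σ : ℝ} (hσ : σ ^ 2 = 1) {a z : ℂ} (hz : σ * z.re < 0)
    (ha : σ * a.re < 0) (haS : a ∈ resolventSet S) (hzS : z ∈ resolventSet S) :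
    halfPlaneOp S σ a z = res S z * (res S a * signProj A σ) := by
  have h1 := halfPlaneOp_eq hres hM hA hσ hz ha haS
  have h2 := (isResolventAt_res hzS).sub_eq (isResolventAt_res haS)
  have h3 := (isResolventAt_res hzS).commute (isResolventAt_res haS)
  set N := halfPlaneOp S σ a z
  set P := res S a * signProj A σ
  have h4 : res S z * N = (res S z - res S a) * N + res S a * (res S z * P) := by
    nth_rw 1 [h1]
    rw [h2, mul_add, mul_add, ← mul_assoc (res S z), ← mul_assoc (res S z), ← mul_assoc (res S a),
      h3.eq, mul_smul_comm, smul_mul_assoc]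
  have h5 : res S a * N = res S a * (res S z * P) := by
    rw [sub_mul] at h4
    have := sub_eq_zero.mpr h4
    rw [← sub_eq_zero, ← this]
    abel
  have hinj := (isResolventAt_res haS).injective
  ext x
  exact hinj (DFunLike.congr_fun h5 x)

include hres hM hA in
theorem exists_isPartResolventAt {σ : ℝ} (hσ : σ ^ 2 = 1) {a z : ℂ} (hz : σ * z.re < 0)
    (ha : σ * a.re < 0) (haS : a ∈ resolventSet S) (hQ : IsIdempotentElem (signProj A σ)) :
    ∃ R, IsPartResolventAt S (signProj A σ) z R := by
  have h1 := halfPlaneOp_eq hres hM hA hσ hz ha haS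
  have hRQ := commute_res_signProj hres hA haS σ
  have hRN := commute_halfPlaneOp hres hM hz ha
    fun η => (isResolventAt_res haS).commute (isResolventAt_res (hres η))
  have hQN := commute_halfPlaneOp hres hM hz ha
    fun η => (commute_res_signProj hres hA (hres η) σ).symm
  refine ⟨_, (isResolventAt_res haS).isPartResolventAt
    (B := (z - a) • halfPlaneOp S σ a z + res S a * signProj A σ) hQ hRQ ?_ ?_ ?_⟩
  · exact (hQN.symm.smul_left _).add_left (hRQ.mul_left (Commute.refl _))
  · exact (hRN.smul_right _).add_right ((Commute.refl _).mul_right hRQ)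
  · nth_rw 1 [h1]
    simp only [mul_add, mul_smul_comm]

include hres hA in
theorem exists_isPartResolventAt_of_mem {σ : ℝ} {z : ℂ} (hzS : z ∈ resolventSet S)
    (hQ : IsIdempotentElem (signProj A σ)) : ∃ R, IsPartResolventAt S (signProj A σ) z R := by
  have hRQ := commute_res_signProj hres hA hzS σ
  refine ⟨_, (isResolventAt_res hzS).isPartResolventAt (B := res S z * signProj A σ) hQ hRQ
    (hRQ.mul_left (Commute.refl _)) ((Commute.refl _).mul_right hRQ) ?_⟩
  rw [sub_self, zero_smul, zero_add]

include hres hM in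
theorem differentiableAt_halfPlaneOp {σ : ℝ} {a z : ℂ} (hz : z.re ≠ 0) (ha : a.re ≠ 0) :
    DifferentiableAt ℂ (halfPlaneOp S σ a) z :=
  (differentiableAt_axisIntegral (continuous_res_axis hres) hM hz ha).fun_const_smul (σ : ℂ)

omit [CompleteSpace X] in
theorem norm_halfPlaneOp_le (hM : ∀ η : ℝ, ‖res S (I * (η : ℂ))‖ ≤ M) {σ : ℝ} (hσ : σ ^ 2 = 1)
    {a z : ℂ} {h : ℝ} (hh : 0 < h) (hz : h ≤ |z.re|) (ha : h ≤ |a.re|) :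
    ‖halfPlaneOp S σ a z‖ ≤
      ‖(2 * Real.pi : ℂ)⁻¹‖ * (M * ∫ η : ℝ, (h ^ 2 + η ^ 2)⁻¹) := by
  have : ‖(σ : ℂ)‖ = 1 := by
    rcases mul_self_eq_one_iff.mp ((sq σ).symm.trans hσ) with rfl | rfl <;> simp
  rw [halfPlaneOp, norm_smul, this, one_mul]
  exact norm_axisIntegral_le hM hh hz ha

include hres hM in
theorem mem_resolventSet_of_abs_re_mul_le {z : ℂ} (hz : |z.re| * M ≤ 1 / 2) :
    z ∈ resolventSet S ∧ ‖res S z‖ ≤ 2 * M := by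
  have hn : ‖z - I * (z.im : ℂ)‖ = |z.re| := by
    have : z - I * (z.im : ℂ) = (z.re : ℂ) := by
      rw [sub_eq_iff_eq_add, mul_comm]; exact (re_add_im z).symm
    rw [this, norm_real, Real.norm_eq_abs]
  have h1 : ‖z - I * (z.im : ℂ)‖ * ‖res S (I * (z.im : ℂ))‖ ≤ 1 / 2 := by
    rw [hn]
    exact (mul_le_mul_of_nonneg_left (hM z.im) (abs_nonneg _)).trans hz
  have hzS := mem_resolventSet_of_norm_lt (hres z.im) (h1.trans_lt (by norm_num))
  exact ⟨hzS, (norm_res_le_two_mul (hres z.im) hzS h1).trans (by linarith [hM z.im])⟩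

include hres hM hA in
open Classical in
/-- The operators `(1 + A) / 2` and `(1 - A) / 2` annihilate each other: the resolvent applied to
their product extends to a bounded entire function. -/
theorem signProj_one_mul_signProj_neg_one
    (hdecay : Tendsto (fun η : ℝ => ‖res S (I * (η : ℂ))‖) (cocompact ℝ) (𝓝 0))
    {h : ℝ} (hh : 0 < h) (hhM : h * M ≤ 1 / 2) :
    signProj A 1 * signProj A (-1) = 0 := by
  have hM0 : 0 ≤ M := (norm_nonneg _).trans (hM 0)
  have haS : (-h : ℂ) ∈ resolventSet S :=
    (mem_resolventSet_of_abs_re_mul_le hres hM (by simpa [abs_of_pos hh] using hhM)).1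
  have hbS : (h : ℂ) ∈ resolventSet S :=
    (mem_resolventSet_of_abs_re_mul_le hres hM (by simpa [abs_of_pos hh] using hhM)).1
  have ha : (1 : ℝ) * (-h : ℂ).re < 0 := by simpa using hh
  have hb : (-1 : ℝ) * (h : ℂ).re < 0 := by simpa using hh
  have ha0 : (-h : ℂ).re ≠ 0 := right_ne_zero_of_mul ha.ne
  have hb0 : (h : ℂ).re ≠ 0 := right_ne_zero_of_mul hb.ne
  set a : ℂ := -(h : ℂ)
  set b : ℂ := (h : ℂ)
  set P := signProj A 1
  set Q := signProj A (-1)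
  have hPQ : Commute P Q :=
    Commute.signProj (Commute.symm (Commute.signProj (Commute.refl A) 1)) (-1)
  set D := res S a * (res S b * (P * Q))
  have hab := (isResolventAt_res haS).commute (isResolventAt_res hbS)
  have hleft {z : ℂ} (hz : z.re < 0) (hzS : z ∈ resolventSet S) :
      res S b * halfPlaneOp S 1 a z * Q = res S z * D := by
    rw [halfPlaneOp_eq_res_mul hres hM hA (one_pow 2) (by simpa using hz) ha haS hzS,
      ← mul_assoc, ((isResolventAt_res hbS).commute (isResolventAt_res hzS)).eq]
    simp only [D, P, Q, mul_assoc]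
    rw [← mul_assoc (res S b) (res S a), ← hab.eq]
    simp only [mul_assoc]
  have hright {z : ℂ} (hz : 0 < z.re) (hzS : z ∈ resolventSet S) :
      res S a * halfPlaneOp S (-1) b z * P = res S z * D := by
    rw [halfPlaneOp_eq_res_mul hres hM hA (by norm_num) (by simpa using hz) hb hbS hzS,
      ← mul_assoc, ((isResolventAt_res haS).commute (isResolventAt_res hzS)).eq]
    simp only [D, mul_assoc, hPQ.eq]
    rfl
  let f : ℂ → X →L[ℂ] X := fun z =>
    if z ∈ resolventSet S then res S z * D
    else if z.re < 0 then res S b * halfPlaneOp S 1 a z * Q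
    else res S a * halfPlaneOp S (-1) b z * P
  have f_res {z : ℂ} (hz : z ∈ resolventSet S) : f z = res S z * D := if_pos hz
  have f_left {z : ℂ} (hz : z.re < 0) : f z = res S b * halfPlaneOp S 1 a z * Q := by
    by_cases hzS : z ∈ resolventSet S
    · rw [f_res hzS, hleft hz hzS]
    · simp only [f, if_neg hzS, if_pos hz]
  have f_right {z : ℂ} (hz : 0 < z.re) : f z = res S a * halfPlaneOp S (-1) b z * P := by
    by_cases hzS : z ∈ resolventSet S
    · rw [f_res hzS, hright hz hzS]
    · simp only [f, if_neg hzS, if_neg hz.not_gt]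
  have hdiff : Differentiable ℂ f := by
    intro z
    rcases lt_trichotomy z.re 0 with hz | hz | hz
    · have hd : DifferentiableAt ℂ (fun z => res S b * halfPlaneOp S 1 a z * Q) z :=
        ((differentiableAt_halfPlaneOp hres hM hz.ne ha0).const_mul _).mul_const _
      refine hd.congr_of_eventuallyEq ?_
      filter_upwards [(isOpen_lt continuous_re continuous_const).mem_nhds hz] with w hw
      exact f_left hw
    · have hzS : z ∈ resolventSet S :=
        (mem_resolventSet_of_abs_re_mul_le hres hM (by simp [hz])).1
      refine ((differentiableAt_res hzS).mul_const D).congr_of_eventuallyEq ?_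
      filter_upwards [eventually_norm_sub_mul_lt z ‖res S z‖] with w hw
      exact f_res (mem_resolventSet_of_norm_lt hzS hw)
    · have hd : DifferentiableAt ℂ (fun z => res S a * halfPlaneOp S (-1) b z * P) z :=
        ((differentiableAt_halfPlaneOp hres hM hz.ne' hb0).const_mul _).mul_const _
      refine hd.congr_of_eventuallyEq ?_
      filter_upwards [(isOpen_lt continuous_const continuous_re).mem_nhds hz] with w hw
      exact f_right hw
  have hbdd : Bornology.IsBounded (Set.range f) := by
    set C := ‖(2 * Real.pi : ℂ)⁻¹‖ * (M * ∫ η : ℝ, (h ^ 2 + η ^ 2)⁻¹)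
    refine isBounded_iff_forall_norm_le.mpr ⟨max (2 * M * ‖D‖)
      (max (‖res S b‖ * C * ‖Q‖) (‖res S a‖ * C * ‖P‖)), ?_⟩
    rintro _ ⟨z, rfl⟩
    by_cases hz : |z.re| ≤ h
    · obtain ⟨hzS, hn⟩ := mem_resolventSet_of_abs_re_mul_le hres hM
        ((mul_le_mul_of_nonneg_right hz hM0).trans hhM)
      refine le_max_of_le_left ?_
      rw [f_res hzS]
      exact (norm_mul_le _ _).trans (by gcongr)
    · have hz' : h ≤ |z.re| := (not_le.mp hz).le
      have hz0 : z.re ≠ 0 := abs_pos.mp (hh.trans_le hz')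
      refine le_max_of_le_right ?_
      rcases lt_or_gt_of_ne hz0 with hneg | hpos
      · refine le_max_of_le_left ?_
        have hC : ‖halfPlaneOp S 1 a z‖ ≤ C :=
          norm_halfPlaneOp_le hM (one_pow 2) hh hz' (by simp [a, abs_of_pos hh])
        rw [f_left hneg]
        exact (norm_mul_le _ _).trans
          (mul_le_mul_of_nonneg_right ((norm_mul_le _ _).trans (by gcongr)) (norm_nonneg _))
      · refine le_max_of_le_right ?_
        have hC : ‖halfPlaneOp S (-1) b z‖ ≤ C :=
          norm_halfPlaneOp_le hM (by norm_num) hh hz' (by simp [b, abs_of_pos hh])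
        rw [f_right hpos]
        exact (norm_mul_le _ _).trans
          (mul_le_mul_of_nonneg_right ((norm_mul_le _ _).trans (by gcongr)) (norm_nonneg _))
  obtain ⟨c, hc⟩ := hdiff.exists_const_forall_eq_of_bounded hbdd
  have hc0 : c = 0 := by
    have h1 : Tendsto (fun η : ℝ => ‖res S (I * (η : ℂ))‖ * ‖D‖) (cocompact ℝ) (𝓝 0) := by
      simpa using hdecay.mul_const ‖D‖
    have h2 : Tendsto (fun _ : ℝ => c) (cocompact ℝ) (𝓝 0) := by
      refine squeeze_zero_norm (fun η => ?_) h1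
      rw [← hc (I * (η : ℂ)), f_res (hres η)]
      exact norm_mul_le _ _
    exact tendsto_nhds_unique tendsto_const_nhds h2
  have h0 := (f_res (hres 0)).symm.trans ((hc _).trans hc0)
  ext x
  refine (isResolventAt_res hbS).injective ((isResolventAt_res haS).injective
    ((isResolventAt_res (hres 0)).injective ?_))
  refine (DFunLike.congr_fun h0 x).trans ?_
  simp

end HalfPlane


/-!
STATEMENT 0 (Theorem of Langer–Tretter / Gohberg–Goldberg–Kaashoek):
Let `X` be a complex Banach space and `S` a closed, densely defined operator in `X` with
`iℝ ⊆ ρ(S)`, `‖(S - iη)⁻¹‖ → 0` as `|η| → ∞`, and such that the principal value integral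
`(1/(πi)) ∫_{iℝ} (S - z)⁻¹ dz` (which, after the substitution `z = iη`, equals
`(1/π) ∫'_ℝ (S - iη)⁻¹ dη`) exists in the strong operator topology.  Then there are
complementary bounded projections `Q₊, Q₋` decomposing `S`, with
`σ(S|_{Q±X}) = σ(S) ∩ ℂ±` and `(1/(πi)) ∫_{iℝ} (S - z)⁻¹ dz x = Q₊x - Q₋x` for all `x`.
-/

theorem statement_0 {X : Type*} [NormedAddCommGroup X] [NormedSpace ℂ X] [CompleteSpace X]
    (S : X →ₗ.[ℂ] X) (hclosed : S.IsClosed) (hdense : Dense (S.domain : Set X))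
    (hres : ∀ η : ℝ, (Complex.I * (η : ℂ)) ∈ resolventSet S)
    (hdecay : Tendsto (fun η : ℝ => ‖res S (Complex.I * (η : ℂ))‖) (cocompact ℝ) (𝓝 0))
    (hpv : ∀ x : X, ∃ L : X,
      Tendsto (fun ρ : ℝ => (Real.pi)⁻¹ • ∫ η in (-ρ)..ρ, res S (Complex.I * (η : ℂ)) x)
        atTop (𝓝 L)) :
    ∃ Qp Qm : X →L[ℂ] X,
      DecomposedBy S Qp Qm ∧
      partSpec S Qp = spec S ∩ {z : ℂ | 0 < z.re} ∧
      partSpec S Qm = spec S ∩ {z : ℂ | z.re < 0} ∧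
      ∀ x : X,
        Tendsto (fun ρ : ℝ => (Real.pi)⁻¹ • ∫ η in (-ρ)..ρ, res S (Complex.I * (η : ℂ)) x)
          atTop (𝓝 (Qp x - Qm x)) := by
  obtain ⟨M, hM⟩ := exists_norm_res_axis_le hres hdecay
  have hM0 : 0 ≤ M := (norm_nonneg _).trans (hM 0)
  choose L hL using hpv
  have hk := continuous_res_axis hres
  have htend : Tendsto (fun (ρ : ℝ) (x : X) =>
      ((Real.pi : ℂ)⁻¹ • ∫ η in (-ρ)..ρ, res S (I * (η : ℂ))) x) atTop (𝓝 L) := by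
    refine tendsto_pi_nhds.mpr fun x => (hL x).congr fun ρ => ?_
    rw [smul_apply, ContinuousLinearMap.intervalIntegral_apply (hk.intervalIntegrable _ _),
      ← ofReal_inv]
    exact RCLike.real_smul_eq_coe_smul (K := ℂ) _ _
  set A : X →L[ℂ] X := continuousLinearMapOfTendsto _ htend with hAdef
  have hA (x : X) : Tendsto (fun ρ : ℝ => (Real.pi)⁻¹ • ∫ η in (-ρ)..ρ, res S (I * (η : ℂ)) x)
      atTop (𝓝 (A x)) := hL x
  have hh : 0 < (2 * (M + 1))⁻¹ := by positivity
  have hhM : (2 * (M + 1))⁻¹ * M ≤ 1 / 2 := by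
    rw [inv_mul_le_iff₀ (by positivity)]
    linarith
  set h := (2 * (M + 1))⁻¹
  have hsum := signProj_one_add_signProj_neg_one A
  have hmul := signProj_one_mul_signProj_neg_one hres hM hA hdecay hh hhM
  have hQp : IsIdempotentElem (signProj A 1) := IsIdempotentElem.of_mul_add hmul hsum |>.1
  have hQm : IsIdempotentElem (signProj A (-1)) := IsIdempotentElem.of_mul_add hmul hsum |>.2
  have hmem (s : ℝ) (hs : |s| ≤ h) : (s : ℂ) ∈ resolventSet S :=
    (mem_resolventSet_of_abs_re_mul_le hres hM
      ((mul_le_mul_of_nonneg_right (by simpa using hs) hM0).trans hhM)).1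
  have haxis {z : ℂ} (hz : z.re = 0) : z ∈ resolventSet S :=
    (mem_resolventSet_of_abs_re_mul_le hres hM (by simp [hz])).1
  have hleft {z : ℂ} (hz : z.re < 0) : ∃ R, IsPartResolventAt S (signProj A 1) z R :=
    exists_isPartResolventAt hres hM hA (one_pow 2) (by simpa using hz)
      (a := ((-h : ℝ) : ℂ)) (by simpa using hh) (hmem _ (by rw [abs_neg, abs_of_pos hh])) hQp
  have hright {z : ℂ} (hz : 0 < z.re) : ∃ R, IsPartResolventAt S (signProj A (-1)) z R :=
    exists_isPartResolventAt hres hM hA (by norm_num) (by simpa using hz)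
      (a := (h : ℂ)) (by simpa using hh) (hmem _ (abs_of_pos hh).le) hQm
  have hdec : DecomposedBy S (signProj A 1) (signProj A (-1)) :=
    ⟨hsum, hQp, hQm,
      (isResolventAt_res (hres 0)).apply_of_commute (commute_res_signProj hres hA (hres 0) 1),
      (isResolventAt_res (hres 0)).apply_of_commute (commute_res_signProj hres hA (hres 0) (-1))⟩
  refine ⟨signProj A 1, signProj A (-1), hdec, ?_, ?_, fun x => ?_⟩
  · ext z
    refine ⟨fun hz => ?_, fun ⟨hz, hre⟩ ⟨Rp, hRp⟩ => ?_⟩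
    · have hzS : z ∈ spec S := fun hzS => hz (exists_isPartResolventAt_of_mem hres hA hzS hQp)
      refine ⟨hzS, ?_⟩
      rcases lt_trichotomy z.re 0 with h1 | h1 | h1
      · exact (hz (hleft h1)).elim
      · exact (hzS (haxis h1)).elim
      · exact h1
    · obtain ⟨Rm, hRm⟩ := hright hre
      exact hz ⟨_, hdec.isResolventAt_add hRp hRm⟩
  · ext z
    refine ⟨fun hz => ?_, fun ⟨hz, hre⟩ ⟨Rm, hRm⟩ => ?_⟩
    · have hzS : z ∈ spec S := fun hzS => hz (exists_isPartResolventAt_of_mem hres hA hzS hQm)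
      refine ⟨hzS, ?_⟩
      rcases lt_trichotomy z.re 0 with h1 | h1 | h1
      · exact h1
      · exact (hzS (haxis h1)).elim
      · exact (hz (hright h1)).elim
    · obtain ⟨Rp, hRp⟩ := hleft hre
      exact hz ⟨_, hdec.isResolventAt_add hRp hRm⟩
  · have hx : signProj A 1 x - signProj A (-1) x = A x :=
      DFunLike.congr_fun (signProj_one_sub_signProj_neg_one A) x
    rw [hx]
    exact hA x

end Paper
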